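/- arXiv:1812.08965 — 2 statements merged into one kernel-verified Lean document; each statement's English description precedes it below -/
import Mathlib

section
/- If the p-values satisfy the PRDN property, then every multiple testing procedure compliant at level α ∈ (0,1) (in particular the Benjamini–Hochberg procedure at level α) satisfies FDR ≤ α + α·log(1/α). -/
open MeasureTheory Finset

attribute [local instance] Classical.propDecidable

/-- Number of rejections of the Benjamini–Hochberg (step-up) procedure at level `α`
applied to the family of p-values `p` indexed by `ι`: the largest `j` such that the
`j`-th smallest p-value is at most `α j / n` (equivalently, at least `j` of the
p-values are at most `α j / n`), and `0` if there is no such `j ≥ 1`. -/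
noncomputable def bhNumRejections {ι : Type*} [Fintype ι] (α : ℝ) (p : ι → ℝ) : ℕ :=
  Nat.findGreatest
    (fun j => j ≤ (Finset.univ.filter (fun i => p i ≤ α * (j : ℝ) / (Fintype.card ι : ℝ))).card)
    (Fintype.card ι)

/-- False discovery proportion `V / max{R, 1}` of the BH procedure at level `α`
with set of true null hypotheses `N₀`. -/
noncomputable def bhFDP {ι : Type*} [Fintype ι] (α : ℝ) (N₀ : Finset ι) (p : ι → ℝ) : ℝ :=
  ((N₀.filter (fun i => p i ≤ α * (bhNumRejections α p : ℝ) / (Fintype.card ι : ℝ))).card : ℝ) /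
    ((max (bhNumRejections α p) 1 : ℕ) : ℝ)

/-- False discovery rate (expected FDP) of the BH procedure at level `α`. -/
noncomputable def bhFDR {Ω : Type*} [MeasurableSpace Ω] {ι : Type*} [Fintype ι]
    (μ : Measure Ω) (α : ℝ) (N₀ : Finset ι) (p : ι → Ω → ℝ) : ℝ :=
  ∫ ω, bhFDP α N₀ (fun i => p i ω) ∂μ

/-- False discovery proportion `V / max{R,1}` of a multiple testing procedure with
rejection set `Rset`, where `N₀` is the set of true null hypotheses. -/
noncomputable def procFDP {ι : Type*} (N₀ Rset : Finset ι) : ℝ :=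
  ((Rset ∩ N₀).card : ℝ) / ((max Rset.card 1 : ℕ) : ℝ)

/-- A rejection set `Rset` is compliant at level `α` if every rejected p-value `p j`
satisfies `p j ≤ α ⋅ |Rset| / n`. -/
def IsCompliant {ι : Type*} [Fintype ι] (α : ℝ) (p : ι → ℝ) (Rset : Finset ι) : Prop :=
  ∀ j ∈ Rset, p j ≤ α * (Rset.card : ℝ) / (Fintype.card ι : ℝ)

/-- An increasing subset `D` of the cube `[0,1]^ι`: membership is preserved when
coordinates increase (while staying at most 1). -/
def IsIncreasingSet {ι : Type*} (D : Set (ι → ℝ)) : Prop :=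
  (∀ x ∈ D, ∀ i, x i ∈ Set.Icc (0:ℝ) 1) ∧
    ∀ x ∈ D, ∀ y : ι → ℝ, (∀ i, x i ≤ y i) → (∀ i, y i ≤ 1) → y ∈ D

/-- Positive regression dependence of the random vector `q`: for every increasing set
`D` and every coordinate `i`, the conditional probability `P(q ∈ D ∣ q i ≤ t)` is
non-decreasing in `t ∈ (0,1]` (stated in cross-multiplied form, so that no division
by a possibly vanishing probability occurs). -/
def PRD {Ω : Type*} [MeasurableSpace Ω] {ι : Type*} (μ : Measure Ω) (q : ι → Ω → ℝ) : Prop :=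
  ∀ D : Set (ι → ℝ), IsIncreasingSet D → ∀ i : ι, ∀ s t : ℝ, 0 < s → s ≤ t → t ≤ 1 →
    μ ({ω | (fun j => q j ω) ∈ D} ∩ {ω | q i ω ≤ s}) * μ {ω | q i ω ≤ t} ≤
      μ ({ω | (fun j => q j ω) ∈ D} ∩ {ω | q i ω ≤ t}) * μ {ω | q i ω ≤ s}

/-- PRDN (positive regression dependence within nulls): the subvector of null
p-values `(p i)_{i ∈ N₀}` satisfies PRD. -/
def PRDN {Ω : Type*} [MeasurableSpace Ω] {n : ℕ} (μ : Measure Ω)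
    (N₀ : Finset (Fin n)) (p : Fin n → Ω → ℝ) : Prop :=
  PRD μ (fun (i : {i // i ∈ N₀}) ω => p i.1 ω)

lemma procFDP_nonneg {ι : Type*} (N₀ R : Finset ι) : 0 ≤ procFDP N₀ R := by
  unfold procFDP; positivity

lemma procFDP_le_one {ι : Type*} (N₀ R : Finset ι) : procFDP N₀ R ≤ 1 := by
  refine div_le_one_of_le₀ ?_ (Nat.cast_nonneg _)
  exact_mod_cast (card_le_card inter_subset_left).trans (le_max_left _ _)

section BHNumRejections

variable {ι : Type*} [Fintype ι]

lemma bhNumRejections_le_card (α : ℝ) (p : ι → ℝ) :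
    bhNumRejections α p ≤ Fintype.card ι :=
  Nat.findGreatest_le _

lemma le_bhNumRejections {α : ℝ} {p : ι → ℝ} {j : ℕ}
    (h : j ≤ (univ.filter (fun i => p i ≤ α * (j : ℝ) / (Fintype.card ι : ℝ))).card) :
    j ≤ bhNumRejections α p :=
  Nat.le_findGreatest (h.trans (card_le_univ _)) h

lemma bhNumRejections_le_card_filter (α : ℝ) (p : ι → ℝ) :
    bhNumRejections α p ≤ (univ.filter (fun i =>
      p i ≤ α * (bhNumRejections α p : ℝ) / (Fintype.card ι : ℝ))).card :=
  Nat.findGreatest_spec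
    (P := fun j => j ≤ (univ.filter (fun i => p i ≤ α * (j : ℝ) / (Fintype.card ι : ℝ))).card)
    (Nat.zero_le _) (Nat.zero_le _)

/-- The BH procedure rejects exactly the p-values below its final threshold. -/
lemma card_filter_bhNumRejections {α : ℝ} (hα : 0 ≤ α) (p : ι → ℝ) :
    (univ.filter (fun i =>
      p i ≤ α * (bhNumRejections α p : ℝ) / (Fintype.card ι : ℝ))).card =
      bhNumRejections α p := by
  refine le_antisymm (le_bhNumRejections (card_le_card ?_)) (bhNumRejections_le_card_filter α p)
  intro i hi
  simp only [mem_filter, mem_univ, true_and] at hi ⊢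
  refine hi.trans ?_
  gcongr
  exact bhNumRejections_le_card_filter α p

lemma bhNumRejections_anti {α : ℝ} {p q : ι → ℝ} (h : ∀ i, p i ≤ q i) :
    bhNumRejections α q ≤ bhNumRejections α p := by
  refine le_bhNumRejections ((bhNumRejections_le_card_filter α q).trans (card_le_card ?_))
  intro i hi
  simp only [mem_filter, mem_univ, true_and] at hi ⊢
  exact (h i).trans hi

lemma bhFDP_eq_procFDP {α : ℝ} (hα : 0 ≤ α) (N₀ : Finset ι) (p : ι → ℝ) :
    bhFDP α N₀ p = procFDP N₀ (univ.filter (fun i =>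
      p i ≤ α * (bhNumRejections α p : ℝ) / (Fintype.card ι : ℝ))) := by
  rw [bhFDP, procFDP, card_filter_bhNumRejections hα]
  congr 3
  ext i
  simp [and_comm]

lemma measurable_bhNumRejections {Ω : Type*} [MeasurableSpace Ω] (α : ℝ) {q : ι → Ω → ℝ}
    (hq : ∀ i, Measurable (q i)) : Measurable fun ω => bhNumRejections α (fun i => q i ω) := by
  refine measurable_findGreatest fun k _ => ?_
  simp only [card_filter]
  refine measurableSet_le measurable_const (Finset.measurable_fun_sum _ fun i _ => ?_)
  exact Measurable.ite (measurableSet_le (hq i) measurable_const) measurable_const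
    measurable_const

lemma isIncreasingSet_bhNumRejections_le (α : ℝ) (r : ℕ) :
    IsIncreasingSet {x : ι → ℝ | (∀ i, x i ∈ Set.Icc (0 : ℝ) 1) ∧ bhNumRejections α x ≤ r} := by
  refine ⟨fun x hx => hx.1, fun x hx y hxy hy => ⟨fun i => ⟨(hx.1 i).1.trans (hxy i), hy i⟩, ?_⟩⟩
  exact (bhNumRejections_anti hxy).trans hx.2

/-- If a compliant procedure has false discovery proportion at least `s`, then the BH procedure
at level `α / s` applied to the null p-values alone rejects something. -/
lemma bhNumRejections_pos_of_le_procFDP {α : ℝ} (hα : 0 ≤ α) {p : ι → ℝ} {N₀ R : Finset ι}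
    (hR : IsCompliant α p R) {s : ℝ} (hs : 0 < s) (h : s ≤ procFDP N₀ R) :
    0 < bhNumRejections (α / s) (fun i : {i // i ∈ N₀} => p i.1) := by
  have hV : 0 < (R ∩ N₀).card := by
    rw [Nat.pos_iff_ne_zero]
    intro h0
    simp only [procFDP, h0, Nat.cast_zero, zero_div] at h
    exact absurd h hs.not_ge
  have hRpos : 0 < R.card := hV.trans_le (card_le_card inter_subset_left)
  have hsR : s * R.card ≤ (R ∩ N₀).card := by
    rwa [procFDP, max_eq_left (Nat.one_le_of_lt hRpos), le_div_iff₀ (by positivity)] at h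
  refine hV.trans_le (le_bhNumRejections ?_)
  rw [← card_map (Function.Embedding.subtype fun i => i ∈ N₀)]
  refine card_le_card fun i hi => ?_
  rw [mem_inter] at hi
  simp only [mem_map, mem_filter, mem_univ, true_and, Function.Embedding.subtype_apply,
    Subtype.exists, exists_and_right, exists_eq_right, Fintype.card_coe]
  refine ⟨hi.2, (hR i hi.1).trans ?_⟩
  have hN : (0 : ℝ) < N₀.card := by exact_mod_cast card_pos.2 ⟨i, hi.2⟩
  have hNn : (N₀.card : ℝ) ≤ Fintype.card ι := by exact_mod_cast card_le_univ N₀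
  calc α * R.card / Fintype.card ι ≤ α * R.card / N₀.card := by gcongr
    _ ≤ α / s * (R ∩ N₀).card / N₀.card := by
      refine div_le_div_of_nonneg_right ?_ hN.le
      rw [div_mul_eq_mul_div, le_div_iff₀ hs, mul_assoc, mul_comm _ s]
      gcongr

end BHNumRejections

section Simes

variable {Ω : Type*} [MeasurableSpace Ω] {μ : Measure Ω} [IsProbabilityMeasure μ]
  {ι : Type*} [Fintype ι]

lemma sum_measureReal_inter_eq {A : Set Ω} (hA : MeasurableSet A) {B : ι → Set Ω}
    (hB : ∀ i, MeasurableSet (B i)) {r : ℕ}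
    (h : ∀ ω ∈ A, (univ.filter (fun i => ω ∈ B i)).card = r) :
    ∑ i, μ.real (A ∩ B i) = r * μ.real A := by
  calc ∑ i, μ.real (A ∩ B i) = ∑ i, ∫ ω in A, (B i).indicator (fun _ => (1 : ℝ)) ω ∂μ := by
        refine sum_congr rfl fun i _ => ?_
        rw [integral_indicator (hB i), setIntegral_const, measureReal_restrict_apply (hB i),
          Set.inter_comm, smul_eq_mul, mul_one]
    _ = ∫ ω in A, ∑ i, (B i).indicator (fun _ => (1 : ℝ)) ω ∂μ :=
        (integral_finsetSum _ fun i _ => (integrable_const _).indicator (hB i)).symm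
    _ = ∫ _ in A, (r : ℝ) ∂μ := by
        refine setIntegral_congr_fun hA fun ω hω => ?_
        simp only [Set.indicator_apply]
        rw [← h ω hω, Finset.sum_boole]
    _ = r * μ.real A := by rw [setIntegral_const, smul_eq_mul, mul_comm]

/-- The contribution of one coordinate to the probability that BH rejects something, under PRD. -/
lemma PRD.sum_measureReal_bhNumRejections_le {q : ι → Ω → ℝ} (hPRD : PRD μ q)
    (hmeas : ∀ i, Measurable (q i)) (hrange : ∀ i ω, q i ω ∈ Set.Icc (0 : ℝ) 1)
    (hnull : ∀ i, ∀ t ∈ Set.Icc (0 : ℝ) 1, μ {ω | q i ω ≤ t} ≤ ENNReal.ofReal t)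
    {x : ℝ} (hx : 0 < x) (hx1 : x ≤ 1) (i : ι) :
    ∑ k ∈ range (Fintype.card ι),
      μ.real ({ω | bhNumRejections x (fun i => q i ω) = k + 1} ∩
        {ω | q i ω ≤ x * ((k + 1 : ℕ) : ℝ) / Fintype.card ι}) / ((k + 1 : ℕ) : ℝ) ≤
      x / Fintype.card ι := by
  have hn : (0 : ℝ) < Fintype.card ι := by exact_mod_cast Fintype.card_pos_iff.2 ⟨i⟩
  set R : Ω → ℕ := fun ω => bhNumRejections x (fun i => q i ω) with hR
  have hRm : Measurable R := measurable_bhNumRejections x hmeas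
  set T : ℕ → Set Ω := fun r => {ω | q i ω ≤ x * (r : ℝ) / Fintype.card ι} with hT
  set a : ℕ → ℝ := fun r => if r = 0 then 0 else μ.real ({ω | R ω ≤ r} ∩ T r) / μ.real (T r)
    with ha
  have ha1 : ∀ r, a r ≤ 1 := fun r => by
    simp only [ha]
    split_ifs
    · exact zero_le_one
    · exact div_le_one_of_le₀ (measureReal_mono Set.inter_subset_right) measureReal_nonneg
  have hmono : ∀ k < Fintype.card ι,
      a k ≤ μ.real ({ω | R ω ≤ k} ∩ T (k + 1)) / μ.real (T (k + 1)) := by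
    intro k hk
    rcases Nat.eq_zero_or_pos k with rfl | hk0
    · simp only [ha, if_true]; positivity
    simp only [ha, hk0.ne', if_false]
    have key := hPRD _ (isIncreasingSet_bhNumRejections_le x k) i (x * (k : ℝ) / Fintype.card ι)
      (x * ((k + 1 : ℕ) : ℝ) / Fintype.card ι) (by positivity) (by gcongr; simp) (by
        rw [div_le_one hn]
        have : ((k + 1 : ℕ) : ℝ) ≤ Fintype.card ι := by exact_mod_cast hk
        nlinarith)
    have hset : {ω | (fun j => q j ω) ∈ {x' : ι → ℝ | (∀ i, x' i ∈ Set.Icc (0 : ℝ) 1) ∧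
        bhNumRejections x x' ≤ k}} = {ω | R ω ≤ k} := by
      ext ω
      simp only [Set.mem_ofPred_eq, hR, and_iff_right_iff_imp]
      exact fun _ i => hrange i ω
    rw [hset] at key
    have key' : μ.real ({ω | R ω ≤ k} ∩ T k) * μ.real (T (k + 1)) ≤
        μ.real ({ω | R ω ≤ k} ∩ T (k + 1)) * μ.real (T k) := by
      simp only [Measure.real, ← ENNReal.toReal_mul]
      exact ENNReal.toReal_mono (by finiteness) key
    rcases (measureReal_nonneg (μ := μ) (s := T k)).eq_or_lt with h0 | h0
    · rw [← h0, div_zero]; positivity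
    have h1 : 0 < μ.real (T (k + 1)) := h0.trans_le <| measureReal_mono fun ω hω => by
      simp only [hT, Set.mem_ofPred_eq] at hω ⊢
      refine hω.trans ?_
      gcongr
      simp
    rwa [div_le_div_iff₀ h0 h1]
  have hterm : ∀ k ∈ range (Fintype.card ι),
      μ.real ({ω | R ω = k + 1} ∩ T (k + 1)) / ((k + 1 : ℕ) : ℝ) ≤
        x / Fintype.card ι * (a (k + 1) - a k) := by
    intro k hk
    rw [mem_range] at hk
    have hsplit : μ.real ({ω | R ω = k + 1} ∩ T (k + 1)) =
        μ.real ({ω | R ω ≤ k + 1} ∩ T (k + 1)) - μ.real ({ω | R ω ≤ k} ∩ T (k + 1)) := by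
      have hsub : {ω | R ω ≤ k} ∩ T (k + 1) ⊆ {ω | R ω ≤ k + 1} ∩ T (k + 1) :=
        Set.inter_subset_inter_left _ fun ω hω => Nat.le_succ_of_le hω
      rw [← measureReal_sdiff hsub ((measurableSet_le hRm measurable_const).inter
        (measurableSet_le (hmeas i) measurable_const))]
      congr 1
      ext ω
      simp only [Set.mem_inter_iff, Set.mem_sdiff, Set.mem_ofPred_eq]
      grind
    have hF : μ.real (T (k + 1)) ≤ x * ((k + 1 : ℕ) : ℝ) / Fintype.card ι := by
      have hk' : ((k + 1 : ℕ) : ℝ) ≤ Fintype.card ι := by exact_mod_cast hk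
      refine ENNReal.toReal_le_of_le_ofReal (by positivity) (hnull i _ ⟨by positivity, ?_⟩)
      rw [div_le_one hn]
      nlinarith
    have hstep := hmono k hk
    rcases (measureReal_nonneg (μ := μ) (s := T (k + 1))).eq_or_lt with h0 | h0
    · have hz : μ.real ({ω | R ω = k + 1} ∩ T (k + 1)) = 0 :=
        le_antisymm ((measureReal_mono Set.inter_subset_right).trans h0.ge) measureReal_nonneg
      have hak : a k ≤ 0 := by simpa [← h0] using hstep
      have hak1 : a (k + 1) = 0 := by simp [ha, ← h0]
      rw [hz, zero_div, hak1]
      exact mul_nonneg (by positivity) (by linarith)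
    have hak1 : a (k + 1) = μ.real ({ω | R ω ≤ k + 1} ∩ T (k + 1)) / μ.real (T (k + 1)) := by
      simp [ha]
    have hdiff : μ.real ({ω | R ω = k + 1} ∩ T (k + 1)) / μ.real (T (k + 1)) ≤
        a (k + 1) - a k := by
      rw [hsplit, sub_div, hak1]
      linarith
    calc μ.real ({ω | R ω = k + 1} ∩ T (k + 1)) / ((k + 1 : ℕ) : ℝ)
        = μ.real (T (k + 1)) / ((k + 1 : ℕ) : ℝ) *
          (μ.real ({ω | R ω = k + 1} ∩ T (k + 1)) / μ.real (T (k + 1))) := by field_simp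
      _ ≤ x / Fintype.card ι * (a (k + 1) - a k) := by
        refine mul_le_mul ?_ hdiff (by positivity) (by positivity)
        rw [div_le_iff₀ (by positivity), div_mul_eq_mul_div]
        exact hF
  refine (sum_le_sum hterm).trans ?_
  rw [← mul_sum, sum_range_sub]
  refine mul_le_of_le_one_right (by positivity) ?_
  have h0 : a 0 = 0 := by simp [ha]
  rw [h0, sub_zero]
  exact ha1 _

/-- **Simes inequality** under PRD. -/
lemma PRD.measureReal_bhNumRejections_pos_le {q : ι → Ω → ℝ} (hPRD : PRD μ q)
    (hmeas : ∀ i, Measurable (q i)) (hrange : ∀ i ω, q i ω ∈ Set.Icc (0 : ℝ) 1)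
    (hnull : ∀ i, ∀ t ∈ Set.Icc (0 : ℝ) 1, μ {ω | q i ω ≤ t} ≤ ENNReal.ofReal t)
    {x : ℝ} (hx : 0 < x) (hx1 : x ≤ 1) :
    μ.real {ω | 0 < bhNumRejections x (fun i => q i ω)} ≤ x := by
  have hRm := measurable_bhNumRejections x hmeas
  calc μ.real {ω | 0 < bhNumRejections x (fun i => q i ω)}
      ≤ μ.real (⋃ k ∈ range (Fintype.card ι),
          {ω | bhNumRejections x (fun i => q i ω) = k + 1}) := by
        refine measureReal_mono (fun ω hω => ?_) (measure_ne_top _ _)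
        have hle := bhNumRejections_le_card x (fun i => q i ω)
        simp only [Set.mem_ofPred_eq, Set.mem_iUnion, mem_range, exists_prop] at hω ⊢
        exact ⟨bhNumRejections x (fun i => q i ω) - 1, by omega, by omega⟩
    _ ≤ ∑ k ∈ range (Fintype.card ι),
          μ.real {ω | bhNumRejections x (fun i => q i ω) = k + 1} :=
        measureReal_biUnion_finset_le _ _
    _ = ∑ k ∈ range (Fintype.card ι), ∑ i,
          μ.real ({ω | bhNumRejections x (fun i => q i ω) = k + 1} ∩
            {ω | q i ω ≤ x * ((k + 1 : ℕ) : ℝ) / Fintype.card ι}) / ((k + 1 : ℕ) : ℝ) := by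
        refine sum_congr rfl fun k _ => ?_
        rw [← sum_div, sum_measureReal_inter_eq (r := k + 1)
          (measurableSet_eq_fun hRm measurable_const)
          (fun i => measurableSet_le (hmeas i) measurable_const), mul_div_cancel_left₀]
        · positivity
        · intro ω hω
          have h := card_filter_bhNumRejections hx.le (fun i => q i ω)
          rw [Set.mem_ofPred_eq] at hω
          rwa [hω] at h
    _ = ∑ i, ∑ k ∈ range (Fintype.card ι),
          μ.real ({ω | bhNumRejections x (fun i => q i ω) = k + 1} ∩
            {ω | q i ω ≤ x * ((k + 1 : ℕ) : ℝ) / Fintype.card ι}) / ((k + 1 : ℕ) : ℝ) :=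
        sum_comm
    _ ≤ ∑ _i : ι, x / Fintype.card ι := sum_le_sum fun i _ =>
        hPRD.sum_measureReal_bhNumRejections_le hmeas hrange hnull hx hx1 i
    _ ≤ x := by
        rw [sum_const, card_univ, nsmul_eq_mul]
        rw [mul_div_assoc', mul_comm]
        exact div_le_of_le_mul₀ (Nat.cast_nonneg _) hx.le le_rfl

/-- A `[0, 1]`-valued function whose tails satisfy `μ {s ≤ f} ≤ α / s` has integral at most
`α + α log (1 / α)`. No measurability is needed, as the integral is `0` otherwise. -/
lemma integral_le_of_measureReal_le_div {f : Ω → ℝ} (h0 : ∀ ω, 0 ≤ f ω) (h1 : ∀ ω, f ω ≤ 1)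
    {α : ℝ} (hα : 0 < α) (hα1 : α < 1)
    (htail : ∀ s, α ≤ s → s ≤ 1 → μ.real {ω | s ≤ f ω} ≤ α / s) :
    ∫ ω, f ω ∂μ ≤ α + α * Real.log (1 / α) := by
  have hlog : 0 ≤ Real.log (1 / α) := Real.log_nonneg (by rw [le_div_iff₀ hα]; linarith)
  by_cases hf : Integrable f μ
  swap
  · rw [integral_undef hf]; positivity
  rw [hf.integral_eq_integral_Ioc_meas_le (.of_forall h0) (.of_forall h1),
    ← intervalIntegral.integral_of_le zero_le_one]
  have hanti : Antitone fun s => μ.real {ω | s ≤ f ω} := fun s t hst =>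
    measureReal_mono fun ω hω => hst.trans hω
  have hint : ∀ a b, IntervalIntegrable (fun s => μ.real {ω | s ≤ f ω}) volume a b :=
    fun a b => hanti.intervalIntegrable
  rw [← intervalIntegral.integral_add_adjacent_intervals (hint 0 α) (hint α 1)]
  refine add_le_add ?_ ?_
  · calc ∫ s in (0 : ℝ)..α, μ.real {ω | s ≤ f ω} ≤ ∫ _ in (0 : ℝ)..α, (1 : ℝ) :=
        intervalIntegral.integral_mono_on hα.le (hint _ _) intervalIntegrable_const
          fun _ _ => measureReal_le_one
      _ = α := by simp
  · have h0mem : (0 : ℝ) ∉ Set.uIcc α 1 := by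
      rw [Set.uIcc_of_le hα1.le]
      exact fun h => hα.not_ge h.1
    calc ∫ s in α..1, μ.real {ω | s ≤ f ω} ≤ ∫ s in α..1, α * (1 / s) := by
          refine intervalIntegral.integral_mono_on hα1.le (hint _ _) ?_ fun s hs => ?_
          · exact (intervalIntegral.intervalIntegrable_one_div
              (fun s hs h => h0mem (h ▸ hs)) continuousOn_id).const_mul _
          · rw [mul_one_div]
            exact htail s hs.1 hs.2
      _ = α * Real.log (1 / α) := by
          rw [intervalIntegral.integral_const_mul, integral_one_div h0mem]

/-- FDR bound for a compliant procedure under PRDN, without measurability of the procedure. -/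
lemma PRDN.integral_procFDP_le {n : ℕ} {p : Fin n → Ω → ℝ} {N₀ : Finset (Fin n)}
    (hPRDN : PRDN μ N₀ p) (hmeas : ∀ i, Measurable (p i))
    (hrange : ∀ i ω, p i ω ∈ Set.Icc (0 : ℝ) 1)
    (hnull : ∀ i ∈ N₀, ∀ t ∈ Set.Icc (0 : ℝ) 1, μ {ω | p i ω ≤ t} ≤ ENNReal.ofReal t)
    {α : ℝ} (hα : 0 < α) (hα1 : α < 1) {proc : Ω → Finset (Fin n)}
    (hcomp : ∀ ω, IsCompliant α (fun i => p i ω) (proc ω)) :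
    ∫ ω, procFDP N₀ (proc ω) ∂μ ≤ α + α * Real.log (1 / α) := by
  refine integral_le_of_measureReal_le_div (fun _ => procFDP_nonneg _ _)
    (fun _ => procFDP_le_one _ _) hα hα1 fun s hs _ => ?_
  have hs0 : 0 < s := hα.trans_le hs
  refine (measureReal_mono fun ω hω => ?_).trans
    (PRD.measureReal_bhNumRejections_pos_le hPRDN (fun i => hmeas i) (fun i => hrange i)
      (fun i => hnull i i.2) (div_pos hα hs0) (div_le_one_of_le₀ hs hs0.le))
  exact bhNumRejections_pos_of_le_procFDP hα.le (hcomp ω) hs0 hω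

end Simes

/-- If the p-values satisfy the PRDN property, then every multiple testing procedure
compliant at level `α ∈ (0,1)` — in particular the Benjamini–Hochberg procedure at
level `α` — satisfies `FDR ≤ α + α log(1/α)`. -/
theorem fdr_control_PRDN
    {Ω : Type*} [MeasurableSpace Ω] (μ : Measure Ω) [IsProbabilityMeasure μ]
    {n : ℕ} (hn : 0 < n) (p : Fin n → Ω → ℝ)
    (hmeas : ∀ i, Measurable (p i))
    (hrange : ∀ i ω, p i ω ∈ Set.Icc (0:ℝ) 1)
    (N₀ : Finset (Fin n)) (hN₀ : 0 < N₀.card)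
    (hnull : ∀ i ∈ N₀, ∀ t ∈ Set.Icc (0:ℝ) 1, μ {ω | p i ω ≤ t} ≤ ENNReal.ofReal t)
    (hPRDN : PRDN μ N₀ p)
    {α : ℝ} (hα : 0 < α) (hα1 : α < 1)
    (proc : Ω → Finset (Fin n))
    (hcomp : ∀ ω, IsCompliant α (fun i => p i ω) (proc ω))
    (hmeasFDP : Measurable fun ω => procFDP N₀ (proc ω)) :
    (∫ ω, procFDP N₀ (proc ω) ∂μ) ≤ α + α * Real.log (1 / α) ∧
      bhFDR μ α N₀ p ≤ α + α * Real.log (1 / α) := by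
  refine ⟨hPRDN.integral_procFDP_le hmeas hrange hnull hα hα1 hcomp, ?_⟩
  simp only [bhFDR, bhFDP_eq_procFDP hα.le]
  refine hPRDN.integral_procFDP_le hmeas hrange hnull hα hα1 fun ω j hj => ?_
  rw [card_filter_bhNumRejections hα.le]
  exact (mem_filter.1 hj).2
end

section
/- (Optimality of the PRDN bound.) For every ε > 0 there exists ᾱ > 0 (depending on ε) such that for every α ∈ (0, ᾱ) there exists N (depending on ε and α) such that for some n ≥ N there is a joint distribution of n p-values satisfying the PRDN property (with super-uniform nulls) for which the Benjamini–Hochberg procedure at level α satisfies FDR > (1 − ε)·(α + α·log(1/α)). -/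
open MeasureTheory Finset

attribute [local instance] Classical.propDecidable

/-- The number of functions mapping a prescribed set `T` of arguments into `S`. -/
theorem card_filter_forall_mem {κ X : Type*} [Fintype κ] [Fintype X] [Nonempty X]
    (T : Finset κ) (S : Finset X) :
    (((univ : Finset (κ → X)).filter (fun b => ∀ c ∈ T, b c ∈ S)).card : ℝ) =
      ((S.card : ℝ) / Fintype.card X) ^ T.card * Fintype.card (κ → X) := by
  have hX : (Fintype.card X : ℝ) ≠ 0 := by exact_mod_cast Fintype.card_ne_zero
  have h : (univ : Finset (κ → X)).filter (fun b => ∀ c ∈ T, b c ∈ S) =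
      Fintype.piFinset (fun c => if c ∈ T then S else univ) := by
    ext b
    simp only [mem_filter, mem_univ, true_and, Fintype.mem_piFinset]
    refine forall_congr' fun c => ?_
    by_cases hc : c ∈ T <;> simp [hc]
  have h2 : Fintype.card κ = T.card + (univ.filter (fun c => c ∉ T)).card := by
    have := Finset.card_filter_add_card_filter_not (s := (univ : Finset κ)) (fun c => c ∈ T)
    simpa using this.symm
  rw [h, Fintype.card_piFinset, Fintype.card_fun, h2]
  simp only [apply_ite Finset.card, Finset.prod_ite, Finset.prod_const, Finset.card_univ]
  have h3 : (univ.filter (fun c => c ∈ T)) = T := by ext; simp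
  rw [h3]
  push_cast
  rw [pow_add, div_pow]
  field_simp

/-- The expectation, under the uniform distribution on `ι × Fin d → X`, of the number of rows
contained in `S`. -/
theorem sum_card_rows {ι X : Type*} [Fintype ι] [Fintype X] [Nonempty X] (d : ℕ)
    (I : Finset ι) (S : Finset X) :
    ∑ b : ι × Fin d → X, ((I.filter (fun i => ∀ c, b (i, c) ∈ S)).card : ℝ) =
      I.card * ((S.card : ℝ) / Fintype.card X) ^ d * Fintype.card (ι × Fin d → X) := by
  simp only [Finset.card_filter, Nat.cast_sum]
  rw [Finset.sum_comm]
  have : ∀ i ∈ I, ∑ b : ι × Fin d → X, ((if ∀ c, b (i, c) ∈ S then 1 else 0 : ℕ) : ℝ) =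
      ((S.card : ℝ) / Fintype.card X) ^ d * Fintype.card (ι × Fin d → X) := by
    intro i _
    have h := card_filter_forall_mem (({i} : Finset ι) ×ˢ (univ : Finset (Fin d))) S
    simp only [card_product, card_singleton, one_mul, Finset.card_univ, Fintype.card_fin] at h
    rw [← Nat.cast_sum, ← Finset.card_filter]
    refine Eq.trans ?_ (h.trans (by congr!))
    rw [Finset.card_filter, Finset.card_filter, Nat.cast_inj]
    refine Finset.sum_congr (by congr!) fun b _ => ?_
    simp
  rw [Finset.sum_congr rfl this]
  simp [mul_assoc]

/-- Second moment of the number of rows contained in `S`. -/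
theorem sum_sq_card_rows_le {ι X : Type*} [Fintype ι] [Fintype X] [Nonempty X] (d : ℕ)
    (I : Finset ι) (S : Finset X) :
    ∑ b : ι × Fin d → X, ((I.filter (fun i => ∀ c, b (i, c) ∈ S)).card : ℝ) ^ 2 ≤
      (I.card * ((S.card : ℝ) / Fintype.card X) ^ d +
        (I.card * ((S.card : ℝ) / Fintype.card X) ^ d) ^ 2) * Fintype.card (ι × Fin d → X) := by
  set q : ℝ := ((S.card : ℝ) / Fintype.card X) ^ d with hq
  have hq0 : 0 ≤ q := by positivity
  have hpair : ∀ i ∈ I, ∀ k ∈ I,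
      ∑ b : ι × Fin d → X, (((if ∀ c, b (i, c) ∈ S then 1 else 0 : ℕ) : ℝ) *
        ((if ∀ c, b (k, c) ∈ S then 1 else 0 : ℕ) : ℝ)) ≤
      ((if i = k then q else 0) + q ^ 2) * Fintype.card (ι × Fin d → X) := by
    intro i _ k _
    have h := card_filter_forall_mem (({i, k} : Finset ι) ×ˢ (univ : Finset (Fin d))) S
    have h' : ∑ b : ι × Fin d → X, (((if ∀ c, b (i, c) ∈ S then 1 else 0 : ℕ) : ℝ) *
        ((if ∀ c, b (k, c) ∈ S then 1 else 0 : ℕ) : ℝ)) =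
        q ^ ({i, k} : Finset ι).card * Fintype.card (ι × Fin d → X) := by
      simp only [card_product, Finset.card_univ, Fintype.card_fin] at h
      rw [hq, ← pow_mul, mul_comm d]
      refine Eq.trans ?_ (h.trans (by congr!))
      rw [Finset.card_filter, Nat.cast_sum]
      refine Finset.sum_congr (by congr!) fun b _ => ?_
      rw [← Nat.cast_mul]
      congr 1
      have hb : (∀ c ∈ ({i, k} : Finset ι) ×ˢ (univ : Finset (Fin d)), b c ∈ S) ↔
          (∀ c, b (i, c) ∈ S) ∧ ∀ c, b (k, c) ∈ S := by
        constructor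
        · exact fun h => ⟨fun c => h _ (by simp), fun c => h _ (by simp)⟩
        · rintro ⟨h1, h2⟩ ⟨l, c⟩ hl
          simp only [mem_product, mem_insert, mem_singleton, mem_univ, and_true] at hl
          rcases hl with rfl | rfl
          · exact h1 c
          · exact h2 c
      simp only [hb, ite_and, mul_ite, mul_one, mul_zero]
      split_ifs <;> rfl
    rw [h']
    refine mul_le_mul_of_nonneg_right ?_ (by positivity)
    by_cases hik : i = k
    · subst hik
      simp only [pair_eq_singleton, card_singleton, pow_one, if_true]
      nlinarith
    · simp [hik, card_pair hik]
  simp only [Finset.card_filter, Nat.cast_sum, sq (∑ _ ∈ I, _), Finset.sum_mul_sum]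
  rw [Finset.sum_comm]
  calc _ ≤ ∑ i ∈ I, ∑ k ∈ I, ((if i = k then q else 0) + q ^ 2) *
        (Fintype.card (ι × Fin d → X) : ℝ) := by
        refine Finset.sum_le_sum fun i hi => ?_
        rw [Finset.sum_comm]
        exact Finset.sum_le_sum fun k hk => hpair i hi k hk
    _ = _ := by
        simp only [← Finset.sum_mul, Finset.sum_add_distrib]
        congr 1
        have : ∀ i ∈ I, (∑ k ∈ I, if i = k then q else 0) = q := by
          intro i hi; simp [hi]
        rw [Finset.sum_congr rfl this]
        simp
        ring

/-- Lower bound for the false discovery proportion from a feasible number `j` of rejections. -/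
theorem one_sub_div_le_bhFDP {ι : Type*} [Fintype ι] {α : ℝ} (hα : 0 ≤ α) (N₀ : Finset ι)
    (p : ι → ℝ) {j z : ℕ} (hj : 0 < j) (hjn : j ≤ Fintype.card ι)
    (hjp : j ≤ (univ.filter (fun i => p i ≤ α * (j : ℝ) / (Fintype.card ι : ℝ))).card)
    (hz : (univ.filter (fun i => i ∉ N₀ ∧ p i ≤ α)).card ≤ z) :
    1 - (z : ℝ) / j ≤ bhFDP α N₀ p := by
  unfold bhFDP
  set R := bhNumRejections α p with hR
  have hjR : j ≤ R := Nat.le_findGreatest hjn hjp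
  have hRn : R ≤ Fintype.card ι := Nat.findGreatest_le _
  have hRp : R ≤ (univ.filter (fun i => p i ≤ α * (R : ℝ) / (Fintype.card ι : ℝ))).card :=
    Nat.findGreatest_spec (P := fun j => j ≤ (Finset.univ.filter
      (fun i => p i ≤ α * (j : ℝ) / (Fintype.card ι : ℝ))).card) hjn hjp
  have hn : (0 : ℝ) < Fintype.card ι := by exact_mod_cast (hj.trans_le hjn)
  have hle : α * (R : ℝ) / (Fintype.card ι : ℝ) ≤ α := by
    rw [div_le_iff₀ hn]
    exact mul_le_mul_of_nonneg_left (by exact_mod_cast hRn) hα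
  set V := (N₀.filter (fun i => p i ≤ α * (R : ℝ) / (Fintype.card ι : ℝ))).card with hV
  have hRV : R ≤ V + z := by
    refine hRp.trans ((Finset.card_le_card (t := N₀.filter
      (fun i => p i ≤ α * (R : ℝ) / (Fintype.card ι : ℝ)) ∪
      univ.filter (fun i => i ∉ N₀ ∧ p i ≤ α)) ?_).trans ((card_union_le _ _).trans ?_))
    · intro i hi
      simp only [mem_filter, mem_univ, true_and, mem_union] at hi ⊢
      by_cases h : i ∈ N₀
      · exact Or.inl ⟨h, hi⟩
      · exact Or.inr ⟨h, hi.trans hle⟩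
    · omega
  have hR0 : 0 < R := hj.trans_le hjR
  rw [max_eq_left (by omega : 1 ≤ R)]
  have hR0' : (0 : ℝ) < R := by exact_mod_cast hR0
  have hj' : (0 : ℝ) < j := by exact_mod_cast hj
  have h1 : (z : ℝ) / R ≤ z / j :=
    div_le_div_of_nonneg_left (by positivity) hj' (by exact_mod_cast hjR)
  have h2 : (R : ℝ) ≤ V + z := by exact_mod_cast hRV
  have h3 : 1 ≤ (V : ℝ) / R + z / R := by
    rw [← add_div, le_div_iff₀ hR0']; linarith
  linarith

theorem bhFDP_nonneg {ι : Type*} [Fintype ι] (α : ℝ) (N₀ : Finset ι) (p : ι → ℝ) :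
    0 ≤ bhFDP α N₀ p := by
  unfold bhFDP; positivity

/-- Probability of an event under the uniform distribution. -/
theorem uniform_apply {Ω : Type*} [Fintype Ω] [Nonempty Ω] (P : Ω → Prop) :
    (@PMF.toMeasure Ω ⊤ (PMF.uniformOfFintype Ω)) {ω | P ω} =
      ENNReal.ofReal (((univ.filter P).card : ℝ) / Fintype.card Ω) := by
  let _ : MeasurableSpace Ω := ⊤
  rw [PMF.toMeasure_uniformOfFintype_apply {ω | P ω} trivial, ENNReal.ofReal_div_of_pos
    (by exact_mod_cast Fintype.card_pos), ENNReal.ofReal_natCast, ENNReal.ofReal_natCast,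
    ← Fintype.card_subtype]
  rfl

/-- A monotone family on a finite distributive lattice with the uniform distribution is PRD as
soon as every coordinate is sup-preserving. -/
theorem prd_uniform {Ω : Type*} [DistribLattice Ω] [Fintype Ω] [Nonempty Ω] {ι : Type*}
    (q : ι → Ω → ℝ) (hq1 : ∀ i ω, q i ω ≤ 1) (hmono : ∀ i, Monotone (q i))
    (hsup : ∀ i x y, q i (x ⊔ y) ≤ max (q i x) (q i y)) :
    @PRD Ω ⊤ ι (@PMF.toMeasure Ω ⊤ (PMF.uniformOfFintype Ω)) q := by
  intro D hD i s t hs hst ht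
  obtain ⟨P, hP⟩ : ∃ P : ℝ → Ω → Prop, ∀ r ω, P r ω ↔ (fun j => q j ω) ∈ D ∧ q i ω ≤ r :=
    ⟨_, fun _ _ => Iff.rfl⟩
  have hPset : ∀ r, {ω | (fun j => q j ω) ∈ D} ∩ {ω | q i ω ≤ r} = {ω | P r ω} := by
    intro r; ext ω; exact (hP r ω).symm
  rw [hPset, hPset,
    uniform_apply, uniform_apply, uniform_apply, uniform_apply,
    ← ENNReal.ofReal_mul (by positivity), ← ENNReal.ofReal_mul (by positivity)]
  refine ENNReal.ofReal_le_ofReal ?_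
  rw [div_mul_div_comm, div_mul_div_comm]
  refine div_le_div_of_nonneg_right ?_ (by positivity)
  let w : Ω → ℝ := fun x => if q i x ≤ t then 1 else 0
  let f : Ω → ℝ := fun x => if (fun j => q j x) ∈ D then 1 else 0
  let g : Ω → ℝ := fun x => if q i x ≤ s then 0 else 1
  have hfkg := fkg (μ := w) (f := f) (g := g)
    (fun x => by dsimp [w]; split_ifs <;> norm_num)
    (fun x => by dsimp [f]; split_ifs <;> norm_num)
    (fun x => by dsimp [g]; split_ifs <;> norm_num)
    (fun x y hxy => by
      have : (fun j => q j x) ∈ D → (fun j => q j y) ∈ D := fun h =>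
        hD.2 _ h _ (fun j => hmono j hxy) (fun j => hq1 j y)
      dsimp [f]; split_ifs <;> simp_all)
    (fun x y hxy => by
      have : q i y ≤ s → q i x ≤ s := fun h => (hmono i hxy).trans h
      dsimp [g]; split_ifs <;> simp_all)
    (fun x y => by
      have h1 : q i x ≤ t → q i (x ⊓ y) ≤ t := fun h => (hmono i inf_le_left).trans h
      have h2 : q i x ≤ t → q i y ≤ t → q i (x ⊔ y) ≤ t := fun h h' =>
        (hsup i x y).trans (max_le h h')
      dsimp [w]
      by_cases hx : q i x ≤ t
      · by_cases hy : q i y ≤ t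
        · simp [hx, hy, h1 hx, h2 hx hy]
        · simp only [hy, if_false, mul_zero]; split_ifs <;> norm_num
      · simp only [hx, if_false, zero_mul]; split_ifs <;> norm_num)
  have hW : ∀ P : Ω → Prop, ((univ.filter P).card : ℝ) = ∑ x, if P x then (1 : ℝ) else 0 := by
    intro P; rw [Finset.card_filter]; push_cast; rfl
  rw [hW (P s), hW (fun x => q i x ≤ t), hW (P t), hW (fun x => q i x ≤ s)]
  have e1 : ∑ x, w x * g x = (∑ x, w x) - ∑ x, if q i x ≤ s then (1 : ℝ) else 0 := by
    rw [← Finset.sum_sub_distrib]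
    refine Finset.sum_congr rfl fun x _ => ?_
    dsimp [w, g]
    by_cases h : q i x ≤ s
    · simp [h, h.trans hst]
    · simp [h]
  have e2 : ∑ x, w x * f x =
      ∑ x, if P t x then (1 : ℝ) else 0 := by
    refine Finset.sum_congr rfl fun x _ => ?_
    by_cases h : q i x ≤ t <;> by_cases h' : (fun j => q j x) ∈ D <;> simp [w, f, hP, h, h']
  have e3 : ∑ x, w x * (f x * g x) = (∑ x, w x * f x) -
      ∑ x, if P s x then (1 : ℝ) else 0 := by
    rw [← Finset.sum_sub_distrib]
    refine Finset.sum_congr rfl fun x _ => ?_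
    by_cases h : q i x ≤ s
    · simp [w, f, g, hP, h, h.trans hst]
    · simp [w, f, g, hP, h]
  rw [e1, e3, e2] at hfkg
  change _ * (∑ x, w x) ≤ _
  linarith

theorem uniform_integral {Ω : Type*} [Fintype Ω] [Nonempty Ω] (f : Ω → ℝ) :
    (@integral Ω ℝ _ _ ⊤ (@PMF.toMeasure Ω ⊤ (PMF.uniformOfFintype Ω)) f) =
      (∑ ω, f ω) / Fintype.card Ω := by
  let _ : MeasurableSpace Ω := ⊤
  rw [PMF.integral_eq_sum]
  simp [← Finset.mul_sum, div_eq_inv_mul]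

theorem log_div_le_sum_Ico {m M : ℕ} (hm : 0 < m) (hmM : m ≤ M) :
    Real.log ((M : ℝ) / m) ≤ ∑ k ∈ Finset.Ico m M, (1 / (k : ℝ)) := by
  have hm' : (0 : ℝ) < m := by exact_mod_cast hm
  induction M, hmM using Nat.le_induction with
  | base => simp [div_self hm'.ne']
  | succ M hM ih =>
    have hM' : (0 : ℝ) < M := by exact_mod_cast hm.trans_le hM
    rw [Finset.sum_Ico_succ_top hM]
    have h1 : ((M + 1 : ℕ) : ℝ) / m = (M / m) * (1 + 1 / M) := by
      push_cast; field_simp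
    rw [h1, Real.log_mul (by positivity) (by positivity)]
    have := Real.log_le_sub_one_of_pos (show (0 : ℝ) < 1 + 1 / M by positivity)
    linarith

/-- The sample space of a common grid level together with `d` grid levels for each hypothesis. -/
abbrev GridSpace (n K d : ℕ) : Type := Fin (K + 1) × (Fin n × Fin d → Fin (K + 1))

/-- The largest of the common grid level and the grid levels attached to hypothesis `i`. -/
noncomputable def gridLevel {n K d : ℕ} (i : Fin n) (ω : GridSpace n K d) : Fin (K + 1) :=
  ω.1 ⊔ univ.sup (fun c => ω.2 (i, c))

/-- The `(d + 1)`-st power of the grid point with index `l`. -/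
noncomputable def gridValue {K : ℕ} (d : ℕ) (l : Fin (K + 1)) : ℝ :=
  (((l : ℕ) + 1 : ℝ) / (K + 1)) ^ (d + 1)

theorem gridLevel_le_iff {n K d : ℕ} (i : Fin n) (ω : GridSpace n K d) (k : Fin (K + 1)) :
    gridLevel i ω ≤ k ↔ ω.1 ≤ k ∧ ∀ c, ω.2 (i, c) ≤ k := by
  simp [gridLevel, Finset.sup_le_iff]

theorem gridLevel_mono {n K d : ℕ} (i : Fin n) :
    Monotone (gridLevel i : GridSpace n K d → Fin (K + 1)) := fun _ _ h =>
  sup_le_sup h.1 (Finset.sup_mono_fun fun c _ => h.2 (i, c))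

theorem gridLevel_sup {n K d : ℕ} (i : Fin n) (x y : GridSpace n K d) :
    gridLevel i (x ⊔ y) ≤ gridLevel i x ⊔ gridLevel i y := by
  rw [gridLevel_le_iff]
  have hx := (gridLevel_le_iff i x _).1 (le_sup_left (b := gridLevel i y))
  have hy := (gridLevel_le_iff i y _).1 (le_sup_right (a := gridLevel i x))
  exact ⟨sup_le hx.1 hy.1, fun c => sup_le (hx.2 c) (hy.2 c)⟩

theorem gridValue_mono {K : ℕ} (d : ℕ) : Monotone (gridValue d : Fin (K + 1) → ℝ) := by
  intro a b h
  have : ((a : ℕ) : ℝ) ≤ (b : ℕ) := by exact_mod_cast h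
  unfold gridValue
  gcongr

theorem gridValue_pos {K : ℕ} (d : ℕ) (l : Fin (K + 1)) : 0 < gridValue d l := by
  unfold gridValue; positivity

theorem gridValue_le_one {K : ℕ} (d : ℕ) (l : Fin (K + 1)) : gridValue d l ≤ 1 := by
  have : ((l : ℕ) : ℝ) ≤ K := by exact_mod_cast Nat.lt_succ_iff.1 l.2
  unfold gridValue
  refine pow_le_one₀ (by positivity) ?_
  rw [div_le_one (by positivity)]
  linarith

theorem card_Iic_div {K : ℕ} (k : Fin (K + 1)) :
    (((Finset.Iic k).card : ℝ) / Fintype.card (Fin (K + 1))) = ((k : ℕ) + 1 : ℝ) / (K + 1) := by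
  simp

theorem card_gridLevel_le {n K d : ℕ} (i : Fin n) (k : Fin (K + 1)) :
    (((univ : Finset (GridSpace n K d)).filter (fun ω => gridLevel i ω ≤ k)).card : ℝ) =
      gridValue d k * Fintype.card (GridSpace n K d) := by
  have h := card_filter_forall_mem (({i} : Finset (Fin n)) ×ˢ (univ : Finset (Fin d)))
    (Finset.Iic k)
  simp only [card_product, card_singleton, one_mul, Finset.card_univ, Fintype.card_fin] at h
  have e : (univ : Finset (GridSpace n K d)).filter (fun ω => gridLevel i ω ≤ k) =
      (Finset.Iic k) ×ˢ (univ.filter (fun b : Fin n × Fin d → Fin (K + 1) =>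
        ∀ c ∈ ({i} : Finset (Fin n)) ×ˢ (univ : Finset (Fin d)), b c ∈ Finset.Iic k)) := by
    ext ω
    simp [gridLevel_le_iff]
  have h' : (((univ.filter (fun b : Fin n × Fin d → Fin (K + 1) =>
      ∀ c ∈ ({i} : Finset (Fin n)) ×ˢ (univ : Finset (Fin d)), b c ∈ Finset.Iic k)).card : ℕ) : ℝ)
      = (((k : ℕ) + 1 : ℝ) / (K + 1)) ^ d * Fintype.card (Fin n × Fin d → Fin (K + 1)) := by
    rw [← card_Iic_div, Fintype.card_fin]
    refine Eq.trans ?_ (h.trans (by congr!))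
    congr!
  rw [e, card_product, Nat.cast_mul, h', Fintype.card_prod, Nat.cast_mul, Fintype.card_fin,
    Fin.card_Iic, gridValue, pow_succ]
  push_cast
  field_simp

theorem gridValue_superuniform {n K d : ℕ} (i : Fin n) {t : ℝ} (ht : 0 ≤ t) :
    (@PMF.toMeasure (GridSpace n K d) ⊤ (PMF.uniformOfFintype _))
      {ω | gridValue d (gridLevel i ω) ≤ t} ≤ ENNReal.ofReal t := by
  rw [uniform_apply]
  refine ENNReal.ofReal_le_ofReal ?_
  have hpos : (0 : ℝ) < Fintype.card (GridSpace n K d) := by exact_mod_cast Fintype.card_pos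
  rw [div_le_iff₀ hpos]
  set G := (univ : Finset (Fin (K + 1))).filter (fun l => gridValue d l ≤ t) with hG
  by_cases hne : G.Nonempty
  · have hk := (mem_filter.1 (G.max'_mem hne)).2
    calc _ ≤ (((univ : Finset (GridSpace n K d)).filter
          (fun ω => gridLevel i ω ≤ G.max' hne)).card : ℝ) := by
          refine Nat.cast_le.2 (Finset.card_le_card fun ω hω => ?_)
          simp only [mem_filter, mem_univ, true_and] at hω ⊢
          exact G.le_max' _ (by simp [hG, hω])
      _ ≤ _ := by
          rw [card_gridLevel_le]
          exact mul_le_mul_of_nonneg_right hk hpos.le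
  · rw [Finset.filter_eq_empty_iff.2, card_empty, Nat.cast_zero]
    · positivity
    · intro ω _ hω
      exact hne ⟨gridLevel i ω, by simp [hG, hω]⟩

theorem prd_gridValue {n K d : ℕ} (N₀ : Finset (Fin n)) :
    @PRD (GridSpace n K d) ⊤ {i // i ∈ N₀} (@PMF.toMeasure _ ⊤ (PMF.uniformOfFintype _))
      (fun i ω => gridValue d (gridLevel i.1 ω)) := by
  refine prd_uniform _ (fun i ω => gridValue_le_one _ _)
    (fun i => (gridValue_mono d).comp (gridLevel_mono i.1)) fun i x y => ?_
  refine (gridValue_mono d (gridLevel_sup i.1 x y)).trans ?_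
  rw [(gridValue_mono d).map_sup]

/-- The number of rejections aimed at when the common grid level is `a`. -/
noncomputable def targetRejections {K : ℕ} (n d : ℕ) (α : ℝ) (a : Fin (K + 1)) : ℕ :=
  ⌈n * gridValue d a / α⌉₊

/-- The number of null hypotheses whose grid level equals the common grid level. -/
noncomputable def smallNulls {n K d : ℕ} (N₀ : Finset (Fin n)) (ω : GridSpace n K d) : ℕ :=
  (N₀.filter (fun i => ∀ c, ω.2 (i, c) ∈ Finset.Iic ω.1)).card

/-- Null p-values are powers of grid levels; the false nulls indexed by the set
`Z (targetRejections - smallNulls)` get p-value `0` and the remaining ones get `1`. -/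
noncomputable def adversarialPValue {n K d : ℕ} (α : ℝ) (N₀ : Finset (Fin n))
    (Z : ℕ → Finset (Fin n)) (i : Fin n) (ω : GridSpace n K d) : ℝ :=
  if i ∈ N₀ then gridValue d (gridLevel i ω)
  else if i ∈ Z (targetRejections n d α ω.1 - smallNulls N₀ ω) then 0 else 1

theorem adversarialPValue_mem_Icc {n K d : ℕ} (α : ℝ) (N₀ : Finset (Fin n))
    (Z : ℕ → Finset (Fin n)) (i : Fin n) (ω : GridSpace n K d) :
    adversarialPValue α N₀ Z i ω ∈ Set.Icc (0 : ℝ) 1 := by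
  unfold adversarialPValue
  split_ifs
  · exact ⟨(gridValue_pos _ _).le, gridValue_le_one _ _⟩
  · simp
  · simp

theorem le_bhFDP_adversarialPValue {n K d : ℕ} {α : ℝ} (hn : 0 < n) (hα : 0 < α) (hα1 : α < 1)
    (N₀ : Finset (Fin n)) (Z : ℕ → Finset (Fin n))
    (hZ : ∀ z ≤ N₀ᶜ.card, Z z ⊆ N₀ᶜ ∧ (Z z).card = z) (ω : GridSpace n K d)
    (hj : targetRejections n d α ω.1 ≤ N₀ᶜ.card) :
    (smallNulls N₀ ω : ℝ) / targetRejections n d α ω.1 -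
        (smallNulls N₀ ω : ℝ) ^ 2 / (targetRejections n d α ω.1 : ℝ) ^ 2 ≤
      bhFDP α N₀ (fun i => adversarialPValue α N₀ Z i ω) := by
  set j := targetRejections n d α ω.1 with hjdef
  set N := smallNulls N₀ ω with hN
  have hn' : (0 : ℝ) < n := by exact_mod_cast hn
  have hj0 : 0 < j := Nat.ceil_pos.2 (by have := gridValue_pos d ω.1; positivity)
  have hj0' : (0 : ℝ) < j := by exact_mod_cast hj0
  rw [← div_pow]
  rcases le_total j N with h | h
  · refine le_trans ?_ (bhFDP_nonneg _ _ _)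
    have : 1 ≤ (N : ℝ) / j := by rw [one_le_div hj0']; exact_mod_cast h
    nlinarith
  have hle : gridValue d ω.1 ≤ α * j / n := by
    rw [le_div_iff₀ hn', ← div_le_iff₀' hα, mul_comm]
    exact Nat.le_ceil _
  obtain ⟨hZ1, hZ2⟩ := hZ (j - N) (by omega)
  have key := one_sub_div_le_bhFDP (z := j - N) hα.le N₀
    (fun i => adversarialPValue α N₀ Z i ω) hj0
    (hj.trans (card_le_univ _)) (by
      calc j = (N₀.filter (fun i => ∀ c, ω.2 (i, c) ∈ Finset.Iic ω.1)).card +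
            (Z (j - N)).card := by rw [hZ2]; change j = N + (j - N); omega
        _ = (N₀.filter (fun i => ∀ c, ω.2 (i, c) ∈ Finset.Iic ω.1) ∪ Z (j - N)).card := by
          refine (card_union_of_disjoint ?_).symm
          refine Finset.disjoint_left.2 fun i hi hi' => ?_
          exact (mem_compl.1 (hZ1 hi')) (mem_filter.1 hi).1
        _ ≤ _ := by
          refine Finset.card_le_card fun i hi => ?_
          simp only [mem_filter, mem_univ, true_and, Fintype.card_fin]
          rcases mem_union.1 hi with hi | hi
          · obtain ⟨h1, h2⟩ := mem_filter.1 hi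
            rw [adversarialPValue, if_pos h1]
            refine (gridValue_mono d ((gridLevel_le_iff i ω ω.1).2 ⟨le_rfl, fun c => ?_⟩)).trans hle
            exact Finset.mem_Iic.1 (h2 c)
          · rw [adversarialPValue, if_neg (mem_compl.1 (hZ1 hi)), if_pos hi]
            positivity) (by
      rw [← hZ2]
      refine Finset.card_le_card fun i hi => ?_
      simp only [mem_filter, mem_univ, true_and] at hi
      by_contra hc
      rw [adversarialPValue, if_neg hi.1, if_neg hc] at hi
      linarith [hi.2])
  refine le_trans ?_ key
  rw [Nat.cast_sub h, sub_div, div_self hj0'.ne']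
  nlinarith [sq_nonneg ((N : ℝ) / j)]

theorem le_sum_bhFDP_adversarialPValue {n K d : ℕ} {α δ : ℝ} (hn : 0 < n) (hα : 0 < α)
    (hα1 : α < 1) (hδ : 0 < δ) (hδ4 : δ ≤ 1 / 4) (N₀ : Finset (Fin n)) (Z : ℕ → Finset (Fin n))
    (hZ : ∀ z ≤ N₀ᶜ.card, Z z ⊆ N₀ᶜ ∧ (Z z).card = z) (hN₀ : (N₀.card : ℝ) = (1 - δ) * n)
    (a : Fin (K + 1)) (hj : targetRejections n d α a ≤ N₀ᶜ.card)
    (ha : α ≤ δ * (((a : ℕ) + 1 : ℝ) / (K + 1))) (hna : α ≤ δ * (n * gridValue d a)) :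
    (1 - 4 * δ) * (α / (((a : ℕ) + 1 : ℝ) / (K + 1))) *
        Fintype.card (Fin n × Fin d → Fin (K + 1)) ≤
      ∑ b : Fin n × Fin d → Fin (K + 1),
        bhFDP α N₀ (fun i => adversarialPValue α N₀ Z i (a, b)) := by
  set j := targetRejections n d α a with hjdef
  set u : ℝ := ((a : ℕ) + 1 : ℝ) / (K + 1) with hu
  have hu0 : 0 < u := by positivity
  have hn' : (0 : ℝ) < n := by exact_mod_cast hn
  have hg : gridValue d a = u ^ d * u := by rw [gridValue, pow_succ]
  set x : ℝ := n * gridValue d a / α with hx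
  have hxj : x ≤ j := Nat.le_ceil _
  have hx1 : 1 ≤ δ * x := by
    rw [hx, mul_div_assoc', one_le_div hα]; exact hna
  have hx0 : 0 < x := by
    by_contra h
    nlinarith
  have hjx : (j : ℝ) ≤ x * (1 + δ) := by
    have : (j : ℝ) < x + 1 := Nat.ceil_lt_add_one hx0.le
    linarith
  have hj0 : (0 : ℝ) < j := hx0.trans_le hxj
  set c : ℝ := ((Fintype.card (Fin n × Fin d → Fin (K + 1)) : ℕ) : ℝ) with hc
  have hc0 : 0 ≤ c := by positivity
  set m : ℝ := N₀.card * u ^ d / j with hm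
  have hu' : α / u * x = n * u ^ d := by
    rw [hx, hg]; field_simp
  have hαu : α / u ≤ δ := by rw [div_le_iff₀ hu0]; exact ha
  have hαu0 : 0 < α / u := by positivity
  have hm1 : m ≤ δ := by
    refine le_trans ?_ hαu
    rw [hm, div_le_iff₀ hj0, hN₀]
    have : (1 - δ) * n * u ^ d ≤ n * u ^ d := by
      have : 0 ≤ n * u ^ d := by positivity
      nlinarith
    calc _ ≤ _ := this
      _ = α / u * x := hu'.symm
      _ ≤ _ := by gcongr
  have hm2 : (1 - 2 * δ) * (α / u) ≤ m := by
    rw [hm, le_div_iff₀ hj0, hN₀]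
    have h1 : (1 - 2 * δ) * (α / u) * j ≤ (1 - 2 * δ) * (α / u) * (x * (1 + δ)) :=
      mul_le_mul_of_nonneg_left hjx (mul_nonneg (by linarith) hαu0.le)
    have h2 : (1 - 2 * δ) * (α / u) * (x * (1 + δ)) = ((1 - 2 * δ) * (1 + δ)) * (n * u ^ d) := by
      rw [← hu']; ring
    have h3 : ((1 - 2 * δ) * (1 + δ)) * (n * u ^ d) ≤ (1 - δ) * (n * u ^ d) :=
      mul_le_mul_of_nonneg_right (by nlinarith) (by positivity)
    linarith
  have hj1 : 1 / (j : ℝ) ≤ δ := by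
    rw [div_le_iff₀ hj0]
    nlinarith
  have hs1 := sum_card_rows d N₀ (Finset.Iic a)
  have hs2 := sum_sq_card_rows_le d N₀ (Finset.Iic a)
  rw [card_Iic_div] at hs1 hs2
  have hsum : ∑ b : Fin n × Fin d → Fin (K + 1), ((smallNulls N₀ (a, b) : ℝ) / j -
      (smallNulls N₀ (a, b) : ℝ) ^ 2 / (j : ℝ) ^ 2) ≤
      ∑ b : Fin n × Fin d → Fin (K + 1),
        bhFDP α N₀ (fun i => adversarialPValue α N₀ Z i (a, b)) :=
    Finset.sum_le_sum fun b _ => le_bhFDP_adversarialPValue hn hα hα1 N₀ Z hZ (a, b) hj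
  refine le_trans ?_ hsum
  rw [Finset.sum_sub_distrib, ← Finset.sum_div, ← Finset.sum_div]
  have hs1' : ∑ b : Fin n × Fin d → Fin (K + 1), (smallNulls N₀ (a, b) : ℝ) =
      N₀.card * u ^ d * c := by
    refine Eq.trans ?_ (hs1.trans (by congr!))
    refine Finset.sum_congr (by congr!) fun b _ => ?_
    unfold smallNulls
    congr!
  have hs2' : ∑ b : Fin n × Fin d → Fin (K + 1), (smallNulls N₀ (a, b) : ℝ) ^ 2 ≤
      (N₀.card * u ^ d + (N₀.card * u ^ d) ^ 2) * c := by
    refine le_trans (le_of_eq ?_) (hs2.trans (le_of_eq (by congr!)))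
    refine Finset.sum_congr (by congr!) fun b _ => ?_
    unfold smallNulls
    congr!
  have hs2'' := div_le_div_of_nonneg_right hs2' (sq_nonneg (j : ℝ))
  have e1 : N₀.card * u ^ d * c / j = m * c := by rw [hm]; ring
  have e2 : (N₀.card * u ^ d + (N₀.card * u ^ d) ^ 2) * c / (j : ℝ) ^ 2 =
      (m * (1 / j) + m ^ 2) * c := by rw [hm]; field_simp
  rw [hs1', e1]
  rw [e2] at hs2''
  have hm0 : 0 ≤ m := by positivity
  have h4 : (1 - 4 * δ) * (α / u) ≤ m - (m * (1 / j) + m ^ 2) := by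
    have h5 : m * (1 / j) ≤ m * δ := mul_le_mul_of_nonneg_left hj1 hm0
    have h6 : m * m ≤ m * δ := mul_le_mul_of_nonneg_left hm1 hm0
    have h7 := mul_le_mul_of_nonneg_right hm2 (by linarith : 0 ≤ 1 - 2 * δ)
    have h8 := mul_nonneg (sq_nonneg δ) hαu0.le
    calc _ ≤ (1 - 2 * δ) * (α / u) * (1 - 2 * δ) := by linarith
      _ ≤ m * (1 - 2 * δ) := h7
      _ ≤ _ := by linarith
  calc _ ≤ (m - (m * (1 / j) + m ^ 2)) * c := mul_le_mul_of_nonneg_right h4 hc0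
    _ = m * c - (m * (1 / j) + m ^ 2) * c := sub_mul _ _ _
    _ ≤ _ := sub_le_sub_left hs2'' _

/-- The part of the harmonic sum over grid points `(l + 1) / (2 H)` in `[α / δ, 1 / 2]`. -/
theorem log_le_sum_grid_inv {α δ : ℝ} {H K : ℕ} (hα : 0 < α) (hδ : 0 < δ) (hαδ : α ≤ δ / 4)
    (hKH : K + 1 = 2 * H) (hH : δ ≤ α * (K + 1)) :
    Real.log (δ / (4 * α)) ≤ ∑ a ∈ (univ : Finset (Fin (K + 1))).filter
      (fun a : Fin (K + 1) => α ≤ δ * (((a : ℕ) + 1 : ℝ) / (K + 1)) ∧ 2 * ((a : ℕ) + 1) ≤ K + 1),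
      1 / ((a : ℕ) + 1 : ℝ) := by
  have hK : (K + 1 : ℝ) = 2 * H := by exact_mod_cast hKH
  set m := ⌈α * (K + 1) / δ⌉₊ with hm
  have hm0 : 0 < m := Nat.ceil_pos.2 (by positivity)
  have hm0' : (0 : ℝ) < m := by exact_mod_cast hm0
  have h1 : 1 ≤ α * (K + 1) / δ := by rw [one_le_div hδ]; exact hH
  have hmle : (m : ℝ) ≤ 2 * (α * (K + 1) / δ) := by
    have := Nat.ceil_lt_add_one (show 0 ≤ α * (K + 1) / δ by positivity)
    linarith
  have h2 : 2 * (α * (K + 1) / δ) = H * (4 * α / δ) := by rw [hK]; ring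
  have h3 : 4 * α / δ ≤ 1 := by rw [div_le_one hδ]; linarith
  have hH0 : (0 : ℝ) ≤ H := by positivity
  have hmH : m ≤ H := by
    have : (m : ℝ) ≤ H := by
      rw [h2] at hmle
      nlinarith
    exact_mod_cast this
  have h4 : Real.log (δ / (4 * α)) ≤ Real.log (((H + 1 : ℕ) : ℝ) / m) := by
    refine Real.log_le_log (by positivity) ?_
    rw [div_le_div_iff₀ (by positivity) hm0']
    calc δ * m ≤ δ * (H * (4 * α / δ)) := by rw [← h2]; gcongr
      _ = H * (4 * α) := by field_simp
      _ ≤ _ := by push_cast; gcongr; linarith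
  refine (h4.trans (log_div_le_sum_Ico hm0 (by omega))).trans (le_of_eq ?_)
  symm
  refine Finset.sum_bij (fun a _ => (a : ℕ) + 1) ?_ ?_ ?_ ?_
  · intro a ha
    obtain ⟨-, ha1, ha2⟩ := mem_filter.1 ha
    refine Finset.mem_Ico.2 ⟨Nat.ceil_le.2 ?_, by omega⟩
    rw [← mul_div_assoc, le_div_iff₀ (by positivity)] at ha1
    rw [div_le_iff₀' hδ]
    push_cast
    exact ha1
  · intro a _ b _ h
    exact Fin.ext (by simpa using h)
  · intro k hk
    obtain ⟨hk1, hk2⟩ := Finset.mem_Ico.1 hk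
    refine ⟨⟨k - 1, by omega⟩, mem_filter.2 ⟨mem_univ _, ?_, ?_⟩, ?_⟩
    · have e : ((k - 1 : ℕ) : ℝ) + 1 = k := by
        rw [Nat.cast_sub (by omega)]; simp
      have h5 := (Nat.le_ceil _).trans (Nat.cast_le (α := ℝ).2 hk1)
      rw [div_le_iff₀' hδ] at h5
      dsimp only
      rw [e, ← mul_div_assoc, le_div_iff₀ (by positivity)]
      exact h5
    · dsimp only; omega
    · dsimp only; omega
  · intro a _
    push_cast
    rfl

theorem le_bhFDR_adversarialPValue {n K d H : ℕ} {α δ : ℝ} (hn : 0 < n) (hα : 0 < α)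
    (hα1 : α < 1) (hδ : 0 < δ) (hδ4 : δ ≤ 1 / 4) (N₀ : Finset (Fin n)) (Z : ℕ → Finset (Fin n))
    (hZ : ∀ z ≤ N₀ᶜ.card, Z z ⊆ N₀ᶜ ∧ (Z z).card = z) (hN₀ : (N₀.card : ℝ) = (1 - δ) * n)
    (hN₁ : (N₀ᶜ.card : ℝ) = δ * n) (hαδ : α ≤ δ / 4) (hKH : K + 1 = 2 * H)
    (hH : δ ≤ α * (K + 1)) (hnK : α * (K + 1 : ℝ) ^ (d + 1) ≤ δ * n)
    (hd : (1 / 2 : ℝ) ^ (d + 1) ≤ α * δ / 2) :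
    (1 - 4 * δ) * α * Real.log (δ / (4 * α)) ≤
      @bhFDR (GridSpace n K d) ⊤ _ _ (@PMF.toMeasure _ ⊤ (PMF.uniformOfFintype _)) α N₀
        (adversarialPValue α N₀ Z) := by
  refine le_of_le_of_eq ?_ (uniform_integral _).symm
  have hn' : (0 : ℝ) < n := by exact_mod_cast hn
  have hcard : (Fintype.card (GridSpace n K d) : ℝ) =
      (K + 1) * (Fintype.card (Fin n × Fin d → Fin (K + 1)) : ℕ) := by
    rw [Fintype.card_prod, Fintype.card_fin]; push_cast; rfl
  set c : ℝ := ((Fintype.card (Fin n × Fin d → Fin (K + 1)) : ℕ) : ℝ) with hc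
  have hc0 : 0 < c := by rw [hc]; exact_mod_cast Fintype.card_pos
  rw [hcard, le_div_iff₀ (by positivity), Fintype.sum_prod_type]
  set G := (univ : Finset (Fin (K + 1))).filter
      (fun a : Fin (K + 1) => α ≤ δ * (((a : ℕ) + 1 : ℝ) / (K + 1)) ∧ 2 * ((a : ℕ) + 1) ≤ K + 1) with hG
  have hrow : ∀ a ∈ G, (1 - 4 * δ) * α * (K + 1) * c * (1 / ((a : ℕ) + 1 : ℝ)) ≤
      ∑ b : Fin n × Fin d → Fin (K + 1),
        bhFDP α N₀ (fun i => adversarialPValue α N₀ Z i (a, b)) := by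
    intro a ha
    obtain ⟨-, ha1, ha2⟩ := mem_filter.1 ha
    refine le_trans (le_of_eq ?_)
      (le_sum_bhFDP_adversarialPValue hn hα hα1 hδ hδ4 N₀ Z hZ hN₀ a ?_ ha1 ?_)
    · rw [← hc]; field_simp
    · refine Nat.ceil_le.2 ?_
      rw [hN₁, div_le_iff₀ hα]
      have h1 : gridValue d a ≤ (1 / 2 : ℝ) ^ (d + 1) := by
        have : (2 * ((a : ℕ) + 1) : ℝ) ≤ K + 1 := by exact_mod_cast ha2
        unfold gridValue
        refine pow_le_pow_left₀ (by positivity) ?_ _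
        rw [div_le_div_iff₀ (by positivity) (by norm_num)]
        linarith
      have h2 : gridValue d a ≤ α * δ := by
        have : 0 < α * δ := by positivity
        linarith
      calc _ ≤ n * (α * δ) := by gcongr
        _ = _ := by ring
    · have h1 : (1 / (K + 1 : ℝ)) ^ (d + 1) ≤ gridValue d a := by
        unfold gridValue
        refine pow_le_pow_left₀ (by positivity) ?_ _
        gcongr
        have : (0 : ℝ) ≤ (a : ℕ) := by positivity
        linarith
      rw [one_div, inv_pow] at h1
      rw [← le_div_iff₀ (by positivity), div_eq_mul_inv] at hnK
      calc α ≤ δ * n * ((K + 1 : ℝ) ^ (d + 1))⁻¹ := hnK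
        _ ≤ δ * n * gridValue d a := by gcongr
        _ = _ := by ring
  have hlog := log_le_sum_grid_inv hα hδ hαδ hKH hH
  rw [← hG] at hlog
  calc _ = (1 - 4 * δ) * α * (K + 1) * c * Real.log (δ / (4 * α)) := by ring
    _ ≤ (1 - 4 * δ) * α * (K + 1) * c * ∑ a ∈ G, (1 / ((a : ℕ) + 1 : ℝ)) := by
        have : 0 ≤ 1 - 4 * δ := by linarith
        gcongr
    _ ≤ ∑ a ∈ G, ∑ b : Fin n × Fin d → Fin (K + 1),
        bhFDP α N₀ (fun i => adversarialPValue α N₀ Z i (a, b)) := by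
        rw [Finset.mul_sum]
        exact Finset.sum_le_sum hrow
    _ ≤ ∑ a, ∑ b : Fin n × Fin d → Fin (K + 1),
        bhFDP α N₀ (fun i => adversarialPValue α N₀ Z i (a, b)) :=
        Finset.sum_le_univ_sum_of_nonneg fun a => Finset.sum_nonneg fun b _ => bhFDP_nonneg _ _ _

/-- For small `α`, the bound `(1 - 4 δ) α log (δ / (4 α))` exceeds
`(1 - ε) (α + α log (1 / α))`. -/
theorem mul_add_mul_log_lt {ε e δ α : ℝ} (he0 : 0 < e) (he1 : e ≤ 1) (heε : e ≤ ε) (hδ : 0 < δ)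
    (hδe : 8 * δ ≤ e) (hα : 0 < α)
    (hαe : α < Real.exp (-(2 / e * (1 + Real.log (4 / δ))))) :
    (1 - ε) * (α + α * Real.log (1 / α)) < (1 - 4 * δ) * α * Real.log (δ / (4 * α)) := by
  set c := Real.log (4 / δ) with hc
  have hc0 : 0 ≤ c := Real.log_nonneg (by rw [le_div_iff₀ hδ]; linarith)
  set L := Real.log (1 / α) with hL
  have hLc : Real.log (δ / (4 * α)) = L - c := by
    rw [hL, hc, ← Real.log_div (by positivity) (by positivity)]
    congr 1
    field_simp
  have hLe : 2 / e * (1 + c) < L := by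
    have := Real.log_lt_log hα hαe
    rw [Real.log_exp] at this
    rw [hL, one_div, Real.log_inv]
    linarith
  have hLe' : 2 * (1 + c) < e * L := by
    rw [div_mul_eq_mul_div, div_lt_iff₀ he0] at hLe
    linarith
  have hL0 : 0 < L := lt_of_le_of_lt (by positivity) hLe
  have hLc0 : 0 < L - c := by nlinarith
  rw [hLc]
  have h1 : (1 - ε) * (1 + L) ≤ (1 - e) * (1 + L) :=
    mul_le_mul_of_nonneg_right (by linarith) (by linarith)
  have h2 : (1 - e / 2) * (L - c) ≤ (1 - 4 * δ) * (L - c) :=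
    mul_le_mul_of_nonneg_right (by linarith) hLc0.le
  have h3 : (1 - e) * (1 + L) < (1 - e / 2) * (L - c) := by
    have := mul_nonneg he0.le hc0
    linarith
  calc _ = α * ((1 - ε) * (1 + L)) := by ring
    _ < α * ((1 - 4 * δ) * (L - c)) := mul_lt_mul_of_pos_left (by linarith) hα
    _ = _ := by ring

/-- **Optimality of the PRDN bound.** For every `ε > 0` there exists `ᾱ > 0`
(depending on `ε`) such that for every `α ∈ (0, ᾱ)` there exists `N` (depending on
`ε` and `α`) such that for some `n ≥ N` there is a joint distribution of `n`
p-values satisfying the PRDN property (with super-uniform nulls) for which the BH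
procedure at level `α` has `FDR > (1 − ε)(α + α log(1/α))`. -/
theorem prdn_bound_optimal :
    ∀ ε : ℝ, 0 < ε → ∃ ᾱ : ℝ, 0 < ᾱ ∧ ∀ α : ℝ, 0 < α → α < ᾱ →
      ∃ N : ℕ, ∃ n : ℕ, N ≤ n ∧
        ∃ (Ω : Type) (_ : MeasurableSpace Ω) (μ : Measure Ω) (_ : IsProbabilityMeasure μ)
          (p : Fin n → Ω → ℝ) (N₀ : Finset (Fin n)),
          0 < N₀.card ∧
          (∀ i, Measurable (p i)) ∧
          (∀ i ω, p i ω ∈ Set.Icc (0:ℝ) 1) ∧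
          (∀ i ∈ N₀, ∀ t ∈ Set.Icc (0:ℝ) 1, μ {ω | p i ω ≤ t} ≤ ENNReal.ofReal t) ∧
          PRDN μ N₀ p ∧
          bhFDR μ α N₀ p > (1 - ε) * (α + α * Real.log (1 / α)) := by
  intro ε hε
  obtain ⟨e, he0, he1, heε⟩ : ∃ e : ℝ, 0 < e ∧ e ≤ 1 ∧ e ≤ ε :=
    ⟨min 1 ε, lt_min one_pos hε, min_le_left _ _, min_le_right _ _⟩
  obtain ⟨s, hs⟩ := exists_nat_ge (8 / e)
  have hs8 : (8 : ℝ) ≤ s := le_trans (by rw [le_div_iff₀ he0]; linarith) hs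
  have hs0 : 8 ≤ s := by exact_mod_cast hs8
  set δ : ℝ := 1 / s with hδdef
  have hδ : 0 < δ := by positivity
  have hsδ : δ * s = 1 := by rw [hδdef]; field_simp
  have hδ8 : δ ≤ 1 / 8 := by rw [hδdef]; gcongr
  have hδe : 8 * δ ≤ e := by
    rw [div_le_iff₀ he0] at hs
    rw [hδdef, mul_one_div, div_le_iff₀ (by positivity)]
    linarith
  refine ⟨min (Real.exp (-(2 / e * (1 + Real.log (4 / δ))))) (δ / 4),
    lt_min (Real.exp_pos _) (by positivity), fun α hα hαlt => ⟨0, ?_⟩⟩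
  have hαe := hαlt.trans_le (min_le_left _ _)
  have hαδ := hαlt.trans_le (min_le_right _ _)
  have hα1 : α < 1 := by linarith
  obtain ⟨d, hd⟩ := exists_pow_lt_of_lt_one (show 0 < α * δ / 2 by positivity)
    (show (1 / 2 : ℝ) < 1 by norm_num)
  have hd' : (1 / 2 : ℝ) ^ (d + 1) ≤ α * δ / 2 := by
    refine le_trans ?_ hd.le
    exact pow_le_pow_of_le_one (by norm_num) (by norm_num) (Nat.le_succ d)
  obtain ⟨h, hh⟩ := exists_nat_ge (δ / α)
  set K := 2 * h + 1 with hK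
  have hH : δ ≤ α * (K + 1) := by
    rw [div_le_iff₀' hα] at hh
    rw [hK]
    push_cast
    have : α * h ≤ α * (2 * h + 1 + 1) := by
      gcongr
      have : (0 : ℝ) ≤ h := by positivity
      linarith
    linarith
  set m := (K + 1) ^ (d + 1) + 2 with hm
  have hm0 : 0 < m := by omega
  have hδn : δ * ((s * m : ℕ) : ℝ) = m := by
    push_cast; rw [← mul_assoc, hsδ, one_mul]
  obtain ⟨N₀, -, hN₀⟩ := Finset.exists_subset_card_eq
    (s := (univ : Finset (Fin (s * m)))) (n := (s - 1) * m)
    (by rw [Finset.card_univ, Fintype.card_fin]; exact Nat.mul_le_mul_right _ (by omega))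
  have hN₁ : N₀ᶜ.card = m := by
    rw [card_compl, hN₀, Fintype.card_fin, ← Nat.sub_mul]
    rw [show s - (s - 1) = 1 by omega, one_mul]
  have hZ : ∀ z, ∃ Z : Finset (Fin (s * m)), z ≤ N₀ᶜ.card → Z ⊆ N₀ᶜ ∧ Z.card = z := by
    intro z
    by_cases hz : z ≤ N₀ᶜ.card
    · obtain ⟨Z, hZ⟩ := Finset.exists_subset_card_eq hz
      exact ⟨Z, fun _ => hZ⟩
    · exact ⟨∅, fun h => absurd h hz⟩
  choose Z hZ using hZ
  refine ⟨s * m, Nat.zero_le _, GridSpace (s * m) K d, ⊤,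
    @PMF.toMeasure _ ⊤ (PMF.uniformOfFintype _), @PMF.toMeasure.isProbabilityMeasure _ ⊤ _,
    adversarialPValue α N₀ Z, N₀, ?_, fun i => measurable_from_top,
    adversarialPValue_mem_Icc α N₀ Z, ?_, ?_, ?_⟩
  · rw [hN₀]
    exact Nat.mul_pos (by omega) hm0
  · intro i hi t ht
    simp only [adversarialPValue, if_pos hi]
    exact gridValue_superuniform i ht.1
  · have hnull : (fun (i : {i // i ∈ N₀}) (ω : GridSpace (s * m) K d) =>
        adversarialPValue α N₀ Z i.1 ω) = fun i ω => gridValue d (gridLevel i.1 ω) := by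
      funext i ω
      rw [adversarialPValue, if_pos i.2]
    have h := prd_gridValue (K := K) (d := d) N₀
    rw [← hnull] at h
    exact h
  · refine lt_of_lt_of_le (mul_add_mul_log_lt he0 he1 heε hδ hδe hα hαe)
      (le_bhFDR_adversarialPValue (H := h + 1) (Nat.mul_pos (by omega) hm0) hα hα1 hδ
        (by linarith) N₀ Z hZ ?_ ?_ hαδ.le (by omega) hH ?_ hd')
    · rw [hN₀, sub_mul, hδn, Nat.cast_mul, Nat.cast_mul, Nat.cast_sub (by omega)]
      push_cast; ring
    · rw [hN₁, hδn]
    · rw [hδn, hm]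
      push_cast
      have : (0 : ℝ) ≤ ((K : ℝ) + 1) ^ (d + 1) := by positivity
      nlinarith
end
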